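/- Let H be a non-abelian simple subgroup of a finite non-abelian simple group G. Assume: (1) there exists an injective group homomorphism j : Aut(H) → Aut(G) such that j(c_h) = c_h for every h ∈ H; and (2) for every subgroup H' of G isomorphic to H there exists an automorphism α of G with α(H) = H'. Let n be the number of conjugacy classes of subgroups of G isomorphic to H, i.e. the cardinality of the quotient of the set {K ≤ G : K ≅ H} by the conjugation action of G. Then n · |Aut(H)| · |C_{Aut(G)}(H)| · |G| = |Aut(G)| · |N_G(H)|, where C_{Aut(G)}(H) is the group of automorphisms of G fixing every element of H and N_G(H) is the normalizer of H in G. -/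

import Mathlib

open scoped Pointwise

namespace SimpleSubgroupCounting

open MulAction

theorem center_eq_bot_of_isSimpleGroup {G : Type*} [Group G] [IsSimpleGroup G]
    (hG : ¬ ∀ a b : G, a * b = b * a) : Subgroup.center G = ⊥ :=
  (IsSimpleGroup.eq_bot_or_eq_top_of_normal (Subgroup.center G) inferInstance).resolve_right
    fun h ↦ hG fun a b ↦
      (Subgroup.mem_center_iff.1 (h ▸ Subgroup.mem_top b : b ∈ Subgroup.center G)) a

theorem conj_injective_of_center_eq_bot {G : Type*} [Group G] (h : Subgroup.center G = ⊥) :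
    Function.Injective (MulAut.conj : G →* MulAut G) := by
  refine (injective_iff_map_eq_one _).2 fun g hg ↦ Subgroup.mem_bot.1 (h ▸ ?_)
  refine Subgroup.mem_center_iff.2 fun x ↦ ?_
  have hx := DFunLike.congr_fun hg x
  rw [MulAut.conj_apply, MulAut.one_apply, mul_inv_eq_iff_eq_mul] at hx
  exact hx.symm

/-- A homomorphism `Aut H → Aut G` compatible with inner automorphisms extends each
automorphism of `H`, provided `G` is centerless. -/
theorem apply_coe_of_conj_compatible {G : Type*} [Group G] (hG : Subgroup.center G = ⊥)
    {H : Subgroup G} {j : MulAut H →* MulAut G}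
    (hj : ∀ h : H, j (MulAut.conj h) = MulAut.conj (h : G)) (φ : MulAut H) (h : H) :
    j φ h = φ h := by
  have conj_map : ∀ {K : Type _} [Group K] (ψ : MulAut K) (k : K),
      MulAut.conj (ψ k) = ψ * MulAut.conj k * ψ⁻¹ := by
    intro K _ ψ k
    ext x
    simp
  apply conj_injective_of_center_eq_bot hG
  rw [conj_map, ← hj, ← map_inv, ← map_mul, ← map_mul, ← conj_map, hj]

/-- If every automorphism of `H` extends to `G` through `j`, then automorphisms of `G`
stabilizing `H` factor uniquely through `j` and the pointwise stabilizer of `H`. -/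
theorem card_stabilizer_eq_card_mulAut_mul {G : Type*} [Group G] {H : Subgroup G}
    {j : MulAut H →* MulAut G} (hj : ∀ (φ : MulAut H) (h : H), j φ h = φ h) :
    Nat.card (stabilizer (MulAut G) H) =
      Nat.card (MulAut H) * Nat.card {β : MulAut G // ∀ h ∈ H, β h = h} := by
  have stab : ∀ α : MulAut G, α ∈ stabilizer (MulAut G) H ↔ H.map α.toMonoidHom = H :=
    fun _ ↦ Iff.rfl
  have hjS : ∀ φ, j φ ∈ stabilizer (MulAut G) H := by
    intro φ
    refine (stab _).2 (le_antisymm ?_ fun x hx ↦ ?_)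
    · rintro _ ⟨x, hx, rfl⟩
      exact (hj φ ⟨x, hx⟩ : j φ x = _) ▸ (φ ⟨x, hx⟩).2
    · exact ⟨φ.symm ⟨x, hx⟩, (φ.symm ⟨x, hx⟩).2,
        (hj φ _).trans (congrArg Subtype.val (φ.apply_symm_apply ⟨x, hx⟩))⟩
  have hCS : ∀ β : MulAut G, (∀ h ∈ H, β h = h) → β ∈ stabilizer (MulAut G) H := by
    intro β hβ
    refine (stab _).2 (le_antisymm ?_ fun x hx ↦ ⟨x, hx, hβ x hx⟩)
    rintro _ ⟨x, hx, rfl⟩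
    exact (hβ x hx : β x = x).symm ▸ hx
  rw [← Nat.card_prod]
  symm
  refine Nat.card_eq_of_bijective
    (fun p : MulAut H × {β : MulAut G // ∀ h ∈ H, β h = h} ↦
      (⟨j p.1 * p.2.1, mul_mem (hjS _) (hCS _ p.2.2)⟩ : stabilizer (MulAut G) H)) ⟨?_, ?_⟩
  · rintro ⟨φ₁, β₁, h₁⟩ ⟨φ₂, β₂, h₂⟩ heq
    have heq' : j φ₁ * β₁ = j φ₂ * β₂ := congrArg Subtype.val heq
    obtain rfl : φ₁ = φ₂ := by
      ext h
      have := DFunLike.congr_fun heq' (h : G)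
      rwa [MulAut.mul_apply, MulAut.mul_apply, h₁ _ h.2, h₂ _ h.2, hj, hj] at this
    obtain rfl := mul_left_cancel heq'
    rfl
  · rintro ⟨α, hα⟩
    let φ : MulAut H := (α.subgroupMap H).trans (MulEquiv.subgroupCongr ((stab α).1 hα))
    have hφ : ∀ h : H, (φ h : G) = α h := fun _ ↦ rfl
    refine ⟨(φ, ⟨(j φ)⁻¹ * α, fun h hh ↦ ?_⟩), Subtype.ext (mul_inv_cancel_left _ _)⟩
    rw [MulAut.mul_apply, ← hφ ⟨h, hh⟩, ← hj, MulAut.inv_apply_self]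

/-- If all stabilizers have cardinality `m`, then the numbers of orbits and points satisfy
`#orbits * #G = #X * m`. -/
theorem card_orbits_mul_card_group {G X : Type*} [Group G] [MulAction G X] (m : ℕ) [Finite X]
    [Finite G] (hm : ∀ x : X, Nat.card (stabilizer G x) = m) :
    Nat.card (Quotient (orbitRel G X)) * Nat.card G = Nat.card X * m := by
  have e : (Σ g : G, fixedBy X g) ≃ Σ x : X, stabilizer G x :=
    { toFun := fun p ↦ ⟨p.2.1, p.1, p.2.2⟩
      invFun := fun p ↦ ⟨p.2.1, p.1, p.2.2⟩
      left_inv := fun _ ↦ rfl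
      right_inv := fun _ ↦ rfl }
  have := Fintype.ofFinite X
  rw [← Nat.card_prod, ← Nat.card_congr (sigmaFixedByEquivOrbitsProdGroup G X),
    Nat.card_congr e, Nat.card_sigma, Finset.sum_congr rfl fun x _ ↦ hm x]
  simp [Nat.card_eq_fintype_card]

theorem card_stabilizer_conjAct {G : Type*} [Group G] (K : Subgroup G) :
    Nat.card (stabilizer (ConjAct G) K) =
      Nat.card (Subgroup.normalizer (K : Set G)) :=
  Nat.card_congr (Equiv.subtypeEquiv ConjAct.ofConjAct.toEquiv fun _ ↦
    Subgroup.conjAct_pointwise_smul_iff)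

/-- The subgroups of `G` isomorphic to `H`, as a set invariant under conjugation. -/
def isomorphicSubgroups {G : Type*} [Group G] (H : Subgroup G) :
    SubMulAction (ConjAct G) (Subgroup G) where
  carrier := {K | Nonempty (K ≃* H)}
  smul_mem' g K := fun ⟨e⟩ ↦ ⟨(Subgroup.equivSMul g K).symm.trans e⟩

end SimpleSubgroupCounting


/-- counting formula.  Under conditions (1) and (2) of the localization
criterion, if `n` is the number of conjugacy classes of subgroups of `G` isomorphic
to `H`, then `n · |Aut H| · |C_{Aut G}(H)| · |G| = |Aut G| · |N_G(H)|`. -/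
theorem statement3 (G : Type*) [Group G] [Finite G] [IsSimpleGroup G]
    (hG : ¬ ∀ a b : G, a * b = b * a)
    (H : Subgroup G) [IsSimpleGroup H]
    (hH : ¬ ∀ a b : H, a * b = b * a)
    (h1 : ∃ j : MulAut H →* MulAut G, Function.Injective j ∧
        ∀ h : H, j (MulAut.conj h) = MulAut.conj (h : G))
    (h2 : ∀ H' : Subgroup G, Nonempty (H' ≃* H) →
        ∃ α : MulAut G, H.map α.toMonoidHom = H') :
    Nat.card (Quotient (Setoid.comap
        (Subtype.val : {K : Subgroup G // Nonempty (K ≃* H)} → Subgroup G)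
        (MulAction.orbitRel (ConjAct G) (Subgroup G)))) *
      Nat.card (MulAut H) * Nat.card {β : MulAut G // ∀ h ∈ H, β h = h} * Nat.card G
    = Nat.card (MulAut G) * Nat.card (Subgroup.normalizer (H : Set G)) := by
  obtain ⟨j, -, hj⟩ := h1
  have hS := SimpleSubgroupCounting.card_stabilizer_eq_card_mulAut_mul
    (SimpleSubgroupCounting.apply_coe_of_conj_compatible
      (SimpleSubgroupCounting.center_eq_bot_of_isSimpleGroup hG) hj)
  let X := SimpleSubgroupCounting.isomorphicSubgroups H
  have hX : (X : Set (Subgroup G)) = MulAction.orbit (MulAut G) H := by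
    ext K
    refine ⟨fun hK ↦ h2 K hK, ?_⟩
    rintro ⟨α, rfl⟩
    exact ⟨(α.subgroupMap H).symm⟩
  have hcard : Nat.card X * Nat.card (MulAction.stabilizer (MulAut G) H) =
      Nat.card (MulAut G) := by
    rw [← Subgroup.card_mul_index (MulAction.stabilizer (MulAut G) H),
      MulAction.index_stabilizer, ← hX, mul_comm]
    rfl
  have hm : ∀ K : X, Nat.card (MulAction.stabilizer (ConjAct G) K) =
      Nat.card (Subgroup.normalizer (H : Set G)) := by
    intro K
    obtain ⟨α, hα⟩ := h2 K.1 K.2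
    rw [SubMulAction.stabilizer_of_subMul, SimpleSubgroupCounting.card_stabilizer_conjAct, ← hα,
      ← Subgroup.map_equiv_normalizer_eq]
    exact (Nat.card_congr (α.subgroupMap _).toEquiv).symm
  have : Finite (ConjAct G) := ‹Finite G›
  have hn := SimpleSubgroupCounting.card_orbits_mul_card_group _ hm
  rw [SubMulAction.orbitRel_of_subMul] at hn
  change Nat.card (Quotient (Setoid.comap
        (Subtype.val : {K : Subgroup G // Nonempty (K ≃* H)} → Subgroup G)
        (MulAction.orbitRel (ConjAct G) (Subgroup G)))) * Nat.card G = _ at hn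
  rw [mul_assoc (Nat.card (Quotient _)), ← hS, mul_right_comm, hn, ← hcard, mul_right_comm]
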